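/- arXiv:1904.09441 — 6 statements merged into one kernel-verified Lean document; each statement's English description precedes it below -/
import Mathlib

section
/- Let β̄, β ≥ 0 and let f : (0,∞) → ℝ be continuously differentiable. Suppose that the derivative f′ is (β̄, β)-locally Lipschitz, i.e. there exists a constant C ≥ 0 such that |f′(x) − f′(y)| ≤ C(1 + x^β̄ + y^β̄ + x^{−β} + y^{−β})|x − y| for all x, y > 0. Then f is (β̄+1, β)-locally Lipschitz: there exists a constant C′ ≥ 0 such that |f(x) − f(y)| ≤ C′(1 + x^{β̄+1} + y^{β̄+1} + x^{−β} + y^{−β})|x − y| for all x, y > 0. -/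
open Real Set

/-- If `f` is continuously differentiable on `(0,∞)` and its derivative `f'`
is `(β̄, β)`-locally Lipschitz, then `f` is `(β̄+1, β)`-locally Lipschitz. -/
theorem stmt_0 (β' β : ℝ) (hβ' : 0 ≤ β') (hβ : 0 ≤ β)
    (f f' : ℝ → ℝ)
    (hderiv : ∀ x ∈ Set.Ioi (0 : ℝ), HasDerivAt f (f' x) x)
    (hcont : ContinuousOn f' (Set.Ioi 0))
    (hlip : ∃ C : ℝ, 0 ≤ C ∧ ∀ x y : ℝ, 0 < x → 0 < y →
      |f' x - f' y| ≤ C * (1 + x ^ β' + y ^ β' + x ^ (-β) + y ^ (-β)) * |x - y|) :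
    ∃ C' : ℝ, 0 ≤ C' ∧ ∀ x y : ℝ, 0 < x → 0 < y →
      |f x - f y| ≤ C' * (1 + x ^ (β' + 1) + y ^ (β' + 1) + x ^ (-β) + y ^ (-β)) * |x - y| := by
  obtain ⟨C, hC, hl⟩ := hlip
  have key : ∀ z : ℝ, 0 < z →
      |f' z| ≤ (|f' 1| + 5 * C) * (1 + z ^ (β' + 1) + z ^ (-β)) := by
    intro z hz
    have h1 := hl z 1 hz one_pos
    simp only [Real.one_rpow] at h1
    have h2 : |f' z| ≤ |f' 1| + |f' z - f' 1| := by
      have := abs_add_le (f' 1) (f' z - f' 1)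
      simpa using this
    have p1 : 0 < z ^ β' := Real.rpow_pos_of_pos hz _
    have p2 : 0 < z ^ (-β) := Real.rpow_pos_of_pos hz _
    have p3 : 0 < z ^ (β' + 1) := Real.rpow_pos_of_pos hz _
    have e : z ^ (β' + 1) = z ^ β' * z := Real.rpow_add_one hz.ne' _
    have h3 : (1 + z ^ β' + 1 + z ^ (-β) + 1) * |z - 1|
        ≤ 5 * (1 + z ^ (β' + 1) + z ^ (-β)) := by
      rcases le_total z 1 with h | h
      · have a1 : z ^ β' ≤ 1 := Real.rpow_le_one hz.le h hβ'
        have a2 : |z - 1| ≤ 1 := by rw [abs_le]; constructor <;> linarith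
        have := mul_le_mul_of_nonneg_left a2
          (by positivity : 0 ≤ 1 + z ^ β' + 1 + z ^ (-β) + 1)
        linarith
      · have a1 : 1 ≤ z ^ β' := Real.one_le_rpow h hβ'
        have a3 : z ^ (-β) ≤ 1 := Real.rpow_le_one_of_one_le_of_nonpos h (by linarith)
        have a2 : |z - 1| ≤ z := by rw [abs_le]; constructor <;> linarith
        have := mul_le_mul (by linarith : 1 + z ^ β' + 1 + z ^ (-β) + 1 ≤ 5 * z ^ β') a2
          (abs_nonneg _) (by positivity)
        linarith
    have h4 := mul_le_mul_of_nonneg_left h3 hC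
    have h5 : 0 ≤ |f' 1| * (z ^ (β' + 1) + z ^ (-β)) := by positivity
    linarith
  refine ⟨|f' 1| + 5 * C, by positivity, fun x y hx hy => ?_⟩
  have hpos : ∀ z ∈ uIcc y x, 0 < z := fun z hz => lt_of_lt_of_le (lt_min hy hx) hz.1
  have := (convex_uIcc y x).norm_image_sub_le_of_norm_hasDerivWithin_le
    (f := f) (f' := f')
    (C := (|f' 1| + 5 * C) * (1 + x ^ (β' + 1) + y ^ (β' + 1) + x ^ (-β) + y ^ (-β)))
    (fun z hz => (hderiv z (hpos z hz)).hasDerivWithinAt) (fun z hz => ?_)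
    left_mem_uIcc right_mem_uIcc
  · simpa [Real.norm_eq_abs] using this
  · have hz0 := hpos z hz
    rw [Real.norm_eq_abs]
    refine (key z hz0).trans (mul_le_mul_of_nonneg_left ?_ (by positivity))
    have q1 := Real.rpow_pos_of_pos hx (β' + 1)
    have q2 := Real.rpow_pos_of_pos hy (β' + 1)
    have q3 := Real.rpow_pos_of_pos hx (-β)
    have q4 := Real.rpow_pos_of_pos hy (-β)
    have up : ∀ w, z ≤ w → z ^ (β' + 1) ≤ w ^ (β' + 1) := fun w h =>
      Real.rpow_le_rpow hz0.le h (by linarith)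
    have dn : ∀ w, 0 < w → w ≤ z → z ^ (-β) ≤ w ^ (-β) := fun w hw h =>
      Real.rpow_le_rpow_of_nonpos hw h (by linarith)
    rcases mem_uIcc.1 hz with ⟨h1, h2⟩ | ⟨h1, h2⟩
    · linarith [up x h2, dn y hy h1]
    · linarith [up y h2, dn x hx h1]
end

section
/- Let α > 1, σ > 0, B₁, B₂ ≥ 0 and let b : [0,∞) → ℝ satisfy b(0) ≥ 0 and b(z) ≤ B₁·z − B₂·z^{2α−1} + b(0) for all z ≥ 0. Let Δt > 0 and let G be a real Gaussian random variable with mean 0 and variance Δt on a probability space. Then for every real p with 0 < 2p ≤ 1 + 2B₂/σ² and every y > 0, E[ ( y · exp( σ·y^{α−1}·G + ( (b(y) − b(0))/y − (σ²/2)·y^{2(α−1)} )·Δt ) )^{2p} ] ≤ y^{2p} · e^{2p·B₁·Δt}. -/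
open Real MeasureTheory ProbabilityTheory

/-- One-step moment estimate for the exponential-Euler scheme: for a centered
Gaussian increment `G` of variance `Δt`, under the growth condition on the drift `b`, the
`2p`-th moment of the multiplicative one-step factor starting from `y > 0` is bounded by
`y^{2p} e^{2p B₁ Δt}` whenever `0 < 2p ≤ 1 + 2B₂/σ²`. -/
theorem stmt_2 {Ω : Type*} [MeasurableSpace Ω] (P : Measure Ω) [IsProbabilityMeasure P]
    (α σ B₁ B₂ : ℝ) (b : ℝ → ℝ)
    (hα : 1 < α) (hσ : 0 < σ) (hB₁ : 0 ≤ B₁) (hB₂ : 0 ≤ B₂)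
    (hb0 : 0 ≤ b 0)
    (hb : ∀ z : ℝ, 0 ≤ z → b z ≤ B₁ * z - B₂ * z ^ (2 * α - 1) + b 0)
    (Δt : ℝ) (hΔt : 0 < Δt)
    (G : Ω → ℝ) (hG : Measure.map G P = gaussianReal 0 Δt.toNNReal)
    (p : ℝ) (hp : 0 < 2 * p) (hp' : 2 * p ≤ 1 + 2 * B₂ / σ ^ 2)
    (y : ℝ) (hy : 0 < y) :
    ∫ ω, (y * Real.exp (σ * y ^ (α - 1) * G ω
        + ((b y - b 0) / y - σ ^ 2 / 2 * y ^ (2 * (α - 1))) * Δt)) ^ (2 * p) ∂P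
      ≤ y ^ (2 * p) * Real.exp (2 * p * B₁ * Δt) := by
  set u : ℝ := y ^ (α - 1) with hu
  have hu2 : y ^ (2 * (α - 1)) = u ^ 2 := by
    rw [hu, ← Real.rpow_natCast, ← Real.rpow_mul hy.le]
    congr 1
    push_cast
    ring
  have hu3 : y ^ (2 * α - 1) = u ^ 2 * y := by
    rw [← hu2, ← Real.rpow_add_one hy.ne']
    congr 1
    ring
  rw [hu2]
  set D : ℝ := (b y - b 0) / y with hD
  have hDle : D ≤ B₁ - B₂ * u ^ 2 := by
    rw [hD, div_le_iff₀ hy]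
    have h := hb y hy.le
    rw [hu3] at h
    linarith
  have hfun : ∀ ω, (y * Real.exp (σ * u * G ω + (D - σ ^ 2 / 2 * u ^ 2) * Δt)) ^ (2 * p)
      = (y ^ (2 * p) * Real.exp (2 * p * ((D - σ ^ 2 / 2 * u ^ 2) * Δt)))
        * Real.exp ((2 * p * σ * u) * G ω) := by
    intro ω
    rw [Real.mul_rpow hy.le (Real.exp_pos _).le, ← Real.exp_mul, mul_assoc (y ^ (2 * p)), ← Real.exp_add]
    congr 2
    ring
  have hmgf : ∫ ω, Real.exp ((2 * p * σ * u) * G ω) ∂P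
      = Real.exp (Δt * (2 * p * σ * u) ^ 2 / 2) := by
    have h := mgf_gaussianReal hG (2 * p * σ * u)
    rw [Real.coe_toNNReal _ hΔt.le, zero_mul, zero_add] at h
    exact h
  simp_rw [hfun]
  rw [integral_const_mul, hmgf, mul_assoc, ← Real.exp_add]
  refine mul_le_mul_of_nonneg_left (Real.exp_le_exp.mpr ?_) (Real.rpow_nonneg hy.le _)
  have hs : (2 * p - 1) * σ ^ 2 ≤ 2 * B₂ := by
    rw [← le_div_iff₀ (by positivity)]
    linarith
  have h1 : D - σ ^ 2 / 2 * u ^ 2 + p * σ ^ 2 * u ^ 2 ≤ B₁ := by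
    nlinarith [mul_le_mul_of_nonneg_right hs (sq_nonneg u)]
  have h2 := mul_le_mul_of_nonneg_left h1 (mul_pos hp hΔt).le
  linarith
end

section
/- Let α > 1, σ > 0, x > 0, T > 0, N ≥ 1 an integer, Δt = T/N, and let b : [0,∞) → ℝ be 2(α−1)-locally Lipschitz with b(0) ≥ 0 and satisfy b(z) ≤ B₁·z − B₂·z^{2α−1} + b(0) for all z ≥ 0, for some constants B₁, B₂ ≥ 0. Let W = (W_t)_{t∈[0,T]} be a measurable stochastic process on a probability space with W_0 = 0 almost surely, such that for all 0 ≤ s ≤ t ≤ T the increment W_t − W_s is Gaussian with mean 0 and variance t − s and is independent of the σ-algebra generated by (W_r)_{r ≤ s}. Let X̄ be the continuous interpolation of the exponential-Euler scheme driven by W. Then for every real p with 0 < 2p ≤ 1 + 2B₂/σ² there exists a constant C_p, depending on p, α, σ, B₁, B₂, b(0) and T but not on x, such that sup_{t∈[0,T]} E[ X̄_t^{2p} ] ≤ C_p (1 + x^{2p}). -/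
open Real MeasureTheory ProbabilityTheory

lemma aux_cont (γ L : ℝ) (hγ : 0 < γ) (b : ℝ → ℝ)
    (h : ∀ u v : ℝ, 0 ≤ u → 0 ≤ v →
      |b u - b v| ≤ L * (1 + u ^ γ + v ^ γ) * |u - v|) :
    Continuous (fun z => b (max 0 z)) := by
  rw [continuous_iff_continuousAt]
  intro v
  unfold ContinuousAt
  rw [tendsto_iff_dist_tendsto_zero]
  have hc : Continuous (fun u : ℝ => L * (1 + (max 0 u) ^ γ + (max 0 v) ^ γ) * |max 0 u - max 0 v|) := by
    have : Continuous (fun u : ℝ => (max 0 u) ^ γ) :=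
      (continuous_const.max continuous_id).rpow_const (fun _ => Or.inr hγ.le)
    fun_prop
  have h0 := hc.tendsto v
  simp only [sub_self, abs_zero, mul_zero] at h0
  refine squeeze_zero (fun _ => dist_nonneg) (fun u => ?_) h0
  rw [Real.dist_eq]
  exact h _ _ (le_max_left _ _) (le_max_left _ _)

/-- the step function -/
noncomputable def stp (b : ℝ → ℝ) (α σ d z g : ℝ) : ℝ :=
  z * Real.exp (σ * z ^ (α - 1) * g + ((b z - b 0) / z - σ ^ 2 / 2 * z ^ (2 * (α - 1))) * d)

lemma stp_meas (b : ℝ → ℝ) (hb : Measurable b) (α σ d : ℝ) :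
    Measurable (fun y : ℝ × ℝ => stp b α σ d y.1 y.2) := by
  unfold stp
  fun_prop

lemma inner_bound (α σ B₁ B₂ : ℝ) (b : ℝ → ℝ) (hσ : 0 < σ)
    (hb : ∀ z : ℝ, 0 ≤ z → b z ≤ B₁ * z - B₂ * z ^ (2 * α - 1) + b 0)
    (q : ℝ) (hq : 0 < q) (hq' : q ≤ 1 + 2 * B₂ / σ ^ 2) (d : ℝ) (hd : 0 ≤ d) (z : ℝ) (hz : 0 < z) :
    ∫⁻ g, ENNReal.ofReal ((stp b α σ d z g) ^ q) ∂(gaussianReal 0 d.toNNReal)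
      ≤ ENNReal.ofReal (Real.exp (q * B₁ * d)) * ENNReal.ofReal (z ^ q) := by
  set k := (b z - b 0) / z - σ ^ 2 / 2 * z ^ (2 * (α - 1)) with hk
  have e1 : ∀ g, (stp b α σ d z g) ^ q
      = (z ^ q * Real.exp (q * k * d)) * Real.exp ((q * σ * z ^ (α - 1)) * g) := by
    intro g
    unfold stp
    rw [Real.mul_rpow hz.le (Real.exp_pos _).le, ← Real.exp_mul, mul_assoc (z ^ q), ← Real.exp_add]
    congr 2
    rw [hk]; ring
  simp_rw [e1]
  rw [← ofReal_integral_eq_lintegral_ofReal]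
  rotate_left
  · exact (integrable_exp_mul_gaussianReal _).const_mul _
  · exact Filter.Eventually.of_forall fun g => by positivity
  rw [integral_const_mul]
  have hm := congrFun (mgf_id_gaussianReal (μ := 0) (v := d.toNNReal)) (q * σ * z ^ (α - 1))
  simp only [mgf, id] at hm
  rw [hm, ← ENNReal.ofReal_mul (Real.exp_pos _).le]
  apply ENNReal.ofReal_le_ofReal
  rw [mul_assoc, ← Real.exp_add, mul_comm (Real.exp _)]
  apply mul_le_mul_of_nonneg_left _ (by positivity)
  apply Real.exp_le_exp.2
  rw [Real.coe_toNNReal _ hd]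
  have e2 : (z ^ (α - 1)) ^ 2 = z ^ (2 * (α - 1)) := by
    rw [← Real.rpow_natCast, ← Real.rpow_mul hz.le]; congr 1; push_cast; ring
  have e3 : z ^ (2 * α - 1) = z * z ^ (2 * (α - 1)) := by
    rw [show 2 * α - 1 = 1 + 2 * (α - 1) by ring, Real.rpow_add hz, Real.rpow_one]
  have hR : 0 < z ^ (2 * (α - 1)) := Real.rpow_pos_of_pos hz _
  have h1 : (b z - b 0) / z ≤ B₁ - B₂ * z ^ (2 * (α - 1)) := by
    rw [div_le_iff₀ hz]
    have := hb z hz.le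
    rw [e3] at this
    nlinarith
  have h2 : (q - 1) * σ ^ 2 ≤ 2 * B₂ := by
    have : q - 1 ≤ 2 * B₂ / σ ^ 2 := by linarith
    rwa [le_div_iff₀ (by positivity)] at this
  have e4 : (q * σ * z ^ (α - 1)) ^ 2 = q ^ 2 * σ ^ 2 * z ^ (2 * (α - 1)) := by
    rw [mul_pow, e2]; ring
  rw [e4, hk]
  set R := z ^ (2 * (α - 1))
  set D := (b z - b 0) / z
  have h3 : D - σ ^ 2 / 2 * R + q * σ ^ 2 * R / 2 ≤ B₁ := by nlinarith
  have h4 := mul_le_mul_of_nonneg_left h3 (mul_nonneg hq.le hd)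
  nlinarith

lemma onestep {Ω : Type} [MeasurableSpace Ω] (P : Measure Ω) [IsProbabilityMeasure P]
    (α σ B₁ B₂ : ℝ) (b : ℝ → ℝ) (hσ : 0 < σ) (hbm : Measurable b)
    (hb : ∀ z : ℝ, 0 ≤ z → b z ≤ B₁ * z - B₂ * z ^ (2 * α - 1) + b 0)
    (q : ℝ) (hq : 0 < q) (hq' : q ≤ 1 + 2 * B₂ / σ ^ 2) (d : ℝ) (hd : 0 ≤ d)
    (Z G : Ω → ℝ) (hZ : Measurable Z) (hG : Measurable G) (hi : IndepFun Z G P)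
    (hpos : ∀ ω, 0 < Z ω) (hmap : Measure.map G P = gaussianReal 0 d.toNNReal) :
    ∫⁻ ω, ENNReal.ofReal ((stp b α σ d (Z ω) (G ω)) ^ q) ∂P
      ≤ ENNReal.ofReal (Real.exp (q * B₁ * d)) * ∫⁻ ω, ENNReal.ofReal ((Z ω) ^ q) ∂P := by
  have hF : Measurable (fun y : ℝ × ℝ => ENNReal.ofReal ((stp b α σ d y.1 y.2) ^ q)) :=
    ((stp_meas b hbm α σ d).pow_const q).ennreal_ofReal
  have h1 := (indepFun_iff_map_prod_eq_prod_map_map hZ.aemeasurable hG.aemeasurable).1 hi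
  have h2 : ∫⁻ ω, ENNReal.ofReal ((stp b α σ d (Z ω) (G ω)) ^ q) ∂P
      = ∫⁻ y, ENNReal.ofReal ((stp b α σ d y.1 y.2) ^ q) ∂(P.map (fun ω => (Z ω, G ω))) := by
    rw [lintegral_map hF (hZ.prodMk hG)]
  rw [h2, h1, hmap, lintegral_prod _ hF.aemeasurable, lintegral_map hF.lintegral_prod_right' hZ,
    ← lintegral_const_mul _ (hZ.pow_const q).ennreal_ofReal]
  exact lintegral_mono fun ω => inner_bound α σ B₁ B₂ b hσ hb q hq hq' d hd _ (hpos ω)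

lemma add_bound (q c d y : ℝ) (hq : 1 ≤ q) (hc : 0 ≤ c) (hd : 0 ≤ d) (hy : 0 ≤ y) :
    (c * d + y) ^ q ≤ Real.exp (q * d) * (y ^ q + d * c ^ q) := by
  have h1d : 0 < 1 + d := by linarith
  have hconv := (convexOn_rpow hq).2 (Set.mem_Ici.2 hy) (Set.mem_Ici.2 hc)
    (show 0 ≤ 1 / (1 + d) by positivity) (show 0 ≤ d / (1 + d) by positivity) (by field_simp)
  simp only [smul_eq_mul] at hconv
  have e : c * d + y = (1 + d) * (1 / (1 + d) * y + d / (1 + d) * c) := by field_simp; ring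
  rw [e, Real.mul_rpow h1d.le (by positivity)]
  have hy' : 0 ≤ y ^ q := Real.rpow_nonneg hy _
  have hc' : 0 ≤ c ^ q := Real.rpow_nonneg hc _
  have h3 : 1 / (1 + d) * y ^ q + d / (1 + d) * c ^ q ≤ y ^ q + d * c ^ q := by
    have : 1 / (1 + d) * y ^ q + d / (1 + d) * c ^ q = (y ^ q + d * c ^ q) / (1 + d) := by
      field_simp
    rw [this]
    exact div_le_self (by positivity) (by linarith)
  have h4 : (1 + d) ^ q ≤ Real.exp (q * d) := by
    rw [mul_comm, Real.exp_mul]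
    exact Real.rpow_le_rpow h1d.le (by linarith [Real.add_one_le_exp d]) (by linarith)
  exact mul_le_mul h4 (hconv.trans h3) (by positivity) (Real.exp_pos _).le

lemma fullstep {Ω : Type} [MeasurableSpace Ω] (P : Measure Ω) [IsProbabilityMeasure P]
    (α σ B₁ B₂ : ℝ) (b : ℝ → ℝ) (hσ : 0 < σ) (hbm : Measurable b) (hB₁ : 0 ≤ B₁) (hb0 : 0 ≤ b 0)
    (hb : ∀ z : ℝ, 0 ≤ z → b z ≤ B₁ * z - B₂ * z ^ (2 * α - 1) + b 0)
    (q : ℝ) (hq : 1 ≤ q) (hq' : q ≤ 1 + 2 * B₂ / σ ^ 2) (s d x : ℝ) (hs : 0 ≤ s) (hd : 0 ≤ d)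
    (hx : 0 < x)
    (Z G : Ω → ℝ) (hZ : Measurable Z) (hG : Measurable G) (hi : IndepFun Z G P)
    (hpos : ∀ ω, 0 < Z ω) (hmap : Measure.map G P = gaussianReal 0 d.toNNReal)
    (hZb : ∫⁻ ω, ENNReal.ofReal ((Z ω) ^ q) ∂P ≤
      ENNReal.ofReal (Real.exp (q * (B₁ + 1) * s) * (x ^ q + s * b 0 ^ q))) :
    ∫⁻ ω, ENNReal.ofReal ((b 0 * d + stp b α σ d (Z ω) (G ω)) ^ q) ∂P
      ≤ ENNReal.ofReal (Real.exp (q * (B₁ + 1) * (s + d)) * (x ^ q + (s + d) * b 0 ^ q)) := by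
  have hS : ∀ ω, 0 ≤ stp b α σ d (Z ω) (G ω) := fun ω =>
    mul_nonneg (hpos ω).le (Real.exp_pos _).le
  have h1 := onestep P α σ B₁ B₂ b hσ hbm hb q (by linarith) hq' d hd Z G hZ hG hi hpos hmap
  have hmeas : Measurable (fun ω => stp b α σ d (Z ω) (G ω)) :=
    (stp_meas b hbm α σ d).comp (hZ.prodMk hG)
  have hc' : 0 ≤ b 0 ^ q := Real.rpow_nonneg hb0 _
  calc ∫⁻ ω, ENNReal.ofReal ((b 0 * d + stp b α σ d (Z ω) (G ω)) ^ q) ∂P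
      ≤ ∫⁻ ω, ENNReal.ofReal (Real.exp (q * d)) *
          (ENNReal.ofReal ((stp b α σ d (Z ω) (G ω)) ^ q) + ENNReal.ofReal (d * b 0 ^ q)) ∂P := by
        refine lintegral_mono fun ω => ?_
        simp only
        rw [← ENNReal.ofReal_add (Real.rpow_nonneg (hS ω) _) (by positivity),
          ← ENNReal.ofReal_mul (Real.exp_pos _).le]
        exact ENNReal.ofReal_le_ofReal (add_bound q _ d _ hq hb0 hd (hS ω))
    _ = ENNReal.ofReal (Real.exp (q * d)) *
          (∫⁻ ω, ENNReal.ofReal ((stp b α σ d (Z ω) (G ω)) ^ q) ∂P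
            + ENNReal.ofReal (d * b 0 ^ q)) := by
        rw [lintegral_const_mul' _ _ ENNReal.ofReal_ne_top, lintegral_add_right _ measurable_const]
        simp
    _ ≤ ENNReal.ofReal (Real.exp (q * d)) * (ENNReal.ofReal (Real.exp (q * B₁ * d)) *
          ENNReal.ofReal (Real.exp (q * (B₁ + 1) * s) * (x ^ q + s * b 0 ^ q))
            + ENNReal.ofReal (d * b 0 ^ q)) := by
        gcongr
        exact h1.trans (by gcongr)
    _ = ENNReal.ofReal (Real.exp (q * d) * (Real.exp (q * B₁ * d) *
          (Real.exp (q * (B₁ + 1) * s) * (x ^ q + s * b 0 ^ q)) + d * b 0 ^ q)) := by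
        have hxq : 0 ≤ x ^ q := Real.rpow_nonneg hx.le _
        rw [ENNReal.ofReal_mul (p := Real.exp (q * d)) (Real.exp_pos _).le,
          ENNReal.ofReal_add (p := Real.exp (q * B₁ * d) * _) (by positivity) (by positivity),
          ENNReal.ofReal_mul (p := Real.exp (q * B₁ * d)) (Real.exp_pos _).le]
    _ ≤ _ := by
        apply ENNReal.ofReal_le_ofReal
        have e : Real.exp (q * (B₁ + 1) * (s + d)) =
            Real.exp (q * d) * (Real.exp (q * B₁ * d) * Real.exp (q * (B₁ + 1) * s)) := by
          rw [← Real.exp_add, ← Real.exp_add]; congr 1; ring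
        rw [e, mul_assoc (Real.exp (q * d))]
        apply mul_le_mul_of_nonneg_left _ (Real.exp_pos _).le
        have h5 : 1 ≤ Real.exp (q * B₁ * d) * Real.exp (q * (B₁ + 1) * s) := by
          rw [← Real.exp_add]; apply Real.one_le_exp; positivity
        have := mul_le_mul_of_nonneg_right h5 (show 0 ≤ d * b 0 ^ q by positivity)
        nlinarith

/-- Main estimate, `q ≥ 1`. -/
lemma main_q {Ω : Type} [m0 : MeasurableSpace Ω] (P : Measure Ω) [IsProbabilityMeasure P]
    (α σ B₁ B₂ T : ℝ) (b : ℝ → ℝ) (hσ : 0 < σ) (hT : 0 < T)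
    (hbm : Measurable b) (hB₁ : 0 ≤ B₁) (hb0 : 0 ≤ b 0)
    (hb : ∀ z : ℝ, 0 ≤ z → b z ≤ B₁ * z - B₂ * z ^ (2 * α - 1) + b 0)
    (q : ℝ) (hq : 1 ≤ q) (hq' : q ≤ 1 + 2 * B₂ / σ ^ 2) (x : ℝ) (hx : 0 < x)
    (N : ℕ) (hN : 1 ≤ N) (W : ℝ → Ω → ℝ) (hW : ∀ t : ℝ, Measurable (W t))
    (hG : ∀ s t : ℝ, 0 ≤ s → s ≤ t → t ≤ T →
        Measure.map (fun ω => W t ω - W s ω) P = gaussianReal 0 (t - s).toNNReal)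
    (hI : ∀ s t : ℝ, 0 ≤ s → s ≤ t → t ≤ T →
        Indep (MeasurableSpace.comap (fun ω => W t ω - W s ω) inferInstance)
          (⨆ r ∈ Set.Iic s, MeasurableSpace.comap (W r) inferInstance) P)
    (X : ℝ → Ω → ℝ) (hX0 : ∀ ω, X 0 ω = x) (hpos : ∀ n : ℕ, n ≤ N → ∀ ω, 0 < X (n * (T / N)) ω)
    (hrec : ∀ n : ℕ, n < N → ∀ ω, X (((n : ℝ) + 1) * (T / N)) ω
      = b 0 * (T / N) + stp b α σ (T / N) (X ((n : ℝ) * (T / N)) ω)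
        (W (((n : ℝ) + 1) * (T / N)) ω - W ((n : ℝ) * (T / N)) ω))
    (t : ℝ) (n : ℕ) (hn : n ≤ N) (hnt : n * (T / N) ≤ t) (htT : t ≤ T)
    (hXt : ∀ ω, X t ω = b 0 * (t - n * (T / N)) + stp b α σ (t - n * (T / N))
      (X ((n : ℝ) * (T / N)) ω) (W t ω - W ((n : ℝ) * (T / N)) ω)) :
    Measurable (X t) ∧ ∫⁻ ω, ENNReal.ofReal ((X t ω) ^ q) ∂P
      ≤ ENNReal.ofReal (Real.exp (q * (B₁ + 1) * t) * (x ^ q + t * b 0 ^ q)) := by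
  have hN0 : (0 : ℝ) < N := by exact_mod_cast hN
  have hD : 0 < T / N := by positivity
  have hle : ∀ k : ℕ, k ≤ N → (k : ℝ) * (T / N) ≤ T := by
    intro k hk
    have : (k : ℝ) ≤ N := by exact_mod_cast hk
    calc (k : ℝ) * (T / N) ≤ N * (T / N) := by gcongr
      _ = T := by field_simp
  let F : ℝ → MeasurableSpace Ω := fun s => ⨆ r ∈ Set.Iic s, MeasurableSpace.comap (W r) inferInstance
  have hF0 : ∀ s, F s ≤ m0 := fun s => iSup₂_le fun r _ => (hW r).comap_le
  have hFm : ∀ s s', s ≤ s' → F s ≤ F s' := fun s s' h =>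
    iSup₂_le fun r hr => le_iSup₂_of_le r (le_trans hr h) le_rfl
  have hWF : ∀ r s, r ≤ s → Measurable[F s] (W r) := fun r s h =>
    Measurable.of_comap_le (le_iSup₂_of_le (f := fun r (_ : r ∈ Set.Iic s) =>
      MeasurableSpace.comap (W r) inferInstance) r h le_rfl)
  have hind : ∀ s t (Z : Ω → ℝ), 0 ≤ s → s ≤ t → t ≤ T → Measurable[F s] Z →
      IndepFun Z (fun ω => W t ω - W s ω) P := by
    intro s t Z h0 h1 h2 hZ
    rw [IndepFun_iff_Indep]
    exact indep_of_indep_of_le_left (hI s t h0 h1 h2).symm hZ.comap_le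
  have key : ∀ k : ℕ, k ≤ N → Measurable[F (k * (T / N))] (X (k * (T / N))) ∧
      ∫⁻ ω, ENNReal.ofReal ((X (k * (T / N)) ω) ^ q) ∂P
      ≤ ENNReal.ofReal (Real.exp (q * (B₁ + 1) * (k * (T / N))) * (x ^ q + (k * (T / N)) * b 0 ^ q)) := by
    intro k
    induction k with
    | zero =>
      intro _
      have : X (((0 : ℕ) : ℝ) * (T / N)) = fun _ => x := by
        funext ω; simp [hX0]
      rw [this]
      exact ⟨measurable_const, by simp⟩
    | succ k ih =>
      intro hk
      obtain ⟨ih1, ih2⟩ := ih (by omega)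
      have hle1 : (k : ℝ) * (T / N) ≤ ((k : ℝ) + 1) * (T / N) := by nlinarith
      have hk' : ((k : ℝ) + 1) * (T / N) ≤ T := by exact_mod_cast hle (k + 1) hk
      have hdiff : ((k : ℝ) + 1) * (T / N) - k * (T / N) = T / N := by ring
      have hE : X (((k + 1 : ℕ) : ℝ) * (T / N)) = fun ω =>
          b 0 * (T / N) + stp b α σ (T / N) (X ((k : ℝ) * (T / N)) ω)
        (W (((k : ℝ) + 1) * (T / N)) ω - W ((k : ℝ) * (T / N)) ω) := by
        funext ω; push_cast; exact hrec k (by omega) ω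
      rw [hE]
      push_cast
      constructor
      · rw [show ((k + 1 : ℕ) : ℝ) = (k : ℝ) + 1 by push_cast; rfl]
        refine Measurable.const_add ?_ _
        exact (stp_meas b hbm α σ (T / N)).comp
          ((ih1.mono (hFm _ _ hle1) le_rfl).prodMk ((hWF _ _ le_rfl).sub (hWF _ _ hle1)))
      · have := fullstep P α σ B₁ B₂ b hσ hbm hB₁ hb0 hb q hq hq' (k * (T / N)) (T / N) x
          (by positivity) hD.le hx (X (k * (T / N)))
          (fun ω => W (((k : ℝ) + 1) * (T / N)) ω - W ((k : ℝ) * (T / N)) ω)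
          (ih1.mono (hF0 _) le_rfl) ((hW _).sub (hW _))
          (hind _ _ _ (by positivity) hle1 hk' ih1) (hpos k (by omega))
          (by rw [hG _ _ (by positivity) hle1 hk', hdiff]) ih2
        rwa [show (k : ℝ) * (T / N) + T / N = (k + 1) * (T / N) by ring] at this
  obtain ⟨k1, k2⟩ := key n hn
  have k1' := k1.mono (hF0 _) le_rfl
  have hE := funext hXt
  rw [hE]
  constructor
  · refine Measurable.const_add ?_ _
    exact (stp_meas b hbm α σ _).comp (k1'.prodMk ((hW _).sub (hW _)))
  · have := fullstep P α σ B₁ B₂ b hσ hbm hB₁ hb0 hb q hq hq' (n * (T / N)) (t - n * (T / N)) x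
      (by positivity) (by linarith) hx (X (n * (T / N)))
      (fun ω => W t ω - W ((n : ℝ) * (T / N)) ω) k1' ((hW _).sub (hW _))
      (hind _ _ _ (by positivity) hnt htT k1) (hpos n hn)
      (hG _ _ (by positivity) hnt htT) k2
    rwa [show (n : ℝ) * (T / N) + (t - n * (T / N)) = t by ring] at this

lemma young (q M y : ℝ) (hq : 0 < q) (hq1 : q ≤ 1) (hM : 0 < M) (hy : 0 ≤ y) :
    y ^ q ≤ M ^ q * (q * (y / M) + (1 - q)) := by
  have h := Real.geom_mean_le_arith_mean2_weighted hq.le (show 0 ≤ 1 - q by linarith)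
    (show 0 ≤ y / M by positivity) zero_le_one (by ring)
  rw [Real.one_rpow, mul_one, mul_one] at h
  have e : y ^ q = M ^ q * (y / M) ^ q := by
    rw [← Real.mul_rpow hM.le (by positivity)]; congr 1; field_simp
  rw [e]
  exact mul_le_mul_of_nonneg_left h (by positivity)

lemma int_of_lint {Ω : Type} [MeasurableSpace Ω] (P : Measure Ω) (f : Ω → ℝ)
    (hf : Measurable f) (h0 : ∀ ω, 0 ≤ f ω) (A : ℝ) (hA : 0 ≤ A)
    (h : ∫⁻ ω, ENNReal.ofReal (f ω) ∂P ≤ ENNReal.ofReal A) :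
    Integrable f P ∧ ∫ ω, f ω ∂P ≤ A := by
  constructor
  · refine ⟨hf.aestronglyMeasurable, ?_⟩
    rw [hasFiniteIntegral_iff_ofReal (Filter.Eventually.of_forall h0)]
    exact h.trans_lt ENNReal.ofReal_lt_top
  · rw [integral_eq_lintegral_of_nonneg_ae (Filter.Eventually.of_forall h0) hf.aestronglyMeasurable]
    exact ENNReal.toReal_le_of_le_ofReal hA h

/-- Moment bound for the continuous-time interpolation of the exponential-Euler
scheme driven by a Brownian motion: for every `p` with `0 < 2p ≤ 1 + 2B₂/σ²` there is a
constant `C_p` (independent of the initial condition `x`) such that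
`sup_{t∈[0,T]} E[X̄_t^{2p}] ≤ C_p (1 + x^{2p})`. -/
theorem stmt_4 (α σ B₁ B₂ T : ℝ) (b : ℝ → ℝ)
    (hα : 1 < α) (hσ : 0 < σ) (hB₁ : 0 ≤ B₁) (hB₂ : 0 ≤ B₂) (hT : 0 < T)
    (hb0 : 0 ≤ b 0)
    (hblip : ∃ L : ℝ, 0 ≤ L ∧ ∀ u v : ℝ, 0 ≤ u → 0 ≤ v →
      |b u - b v| ≤ L * (1 + u ^ (2 * (α - 1)) + v ^ (2 * (α - 1))) * |u - v|)
    (hb : ∀ z : ℝ, 0 ≤ z → b z ≤ B₁ * z - B₂ * z ^ (2 * α - 1) + b 0)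
    (p : ℝ) (hp : 0 < 2 * p) (hp' : 2 * p ≤ 1 + 2 * B₂ / σ ^ 2) :
    ∃ C : ℝ, ∀ x : ℝ, 0 < x → ∀ N : ℕ, 1 ≤ N →
      ∀ (Ω : Type) (_ : MeasurableSpace Ω) (P : Measure Ω), IsProbabilityMeasure P →
      ∀ W : ℝ → Ω → ℝ,
      (∀ t : ℝ, Measurable (W t)) →
      (∀ᵐ ω ∂P, W 0 ω = 0) →
      -- Gaussian increments of variance `t - s`
      (∀ s t : ℝ, 0 ≤ s → s ≤ t → t ≤ T →
        Measure.map (fun ω => W t ω - W s ω) P = gaussianReal 0 (t - s).toNNReal) →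
      -- increments independent of the past
      (∀ s t : ℝ, 0 ≤ s → s ≤ t → t ≤ T →
        Indep (MeasurableSpace.comap (fun ω => W t ω - W s ω) inferInstance)
          (⨆ r ∈ Set.Iic s, MeasurableSpace.comap (W r) inferInstance) P) →
      ∀ Xbar : ℝ → Ω → ℝ,
      -- initial condition
      (∀ ω, Xbar 0 ω = x) →
      -- grid recursion with increments `ΔW_n = W_{t_{n+1}} − W_{t_n}`
      (∀ n : ℕ, n < N → ∀ ω, Xbar (((n : ℝ) + 1) * (T / N)) ω
          = b 0 * (T / N) + Xbar ((n : ℝ) * (T / N)) ω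
            * Real.exp (σ * (Xbar ((n : ℝ) * (T / N)) ω) ^ (α - 1)
                * (W (((n : ℝ) + 1) * (T / N)) ω - W ((n : ℝ) * (T / N)) ω)
              + ((b (Xbar ((n : ℝ) * (T / N)) ω) - b 0) / (Xbar ((n : ℝ) * (T / N)) ω)
                - σ ^ 2 / 2 * (Xbar ((n : ℝ) * (T / N)) ω) ^ (2 * (α - 1))) * (T / N))) →
      -- continuous interpolation, with `η(t) = Δt⌊t/Δt⌋` and `δ(t) = t − η(t)`
      (∀ t : ℝ, 0 ≤ t → t ≤ T → ∀ ω, Xbar t ω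
          = b 0 * (t - (T / N) * (⌊t / (T / N)⌋ : ℝ))
            + Xbar ((T / N) * (⌊t / (T / N)⌋ : ℝ)) ω
            * Real.exp (σ * (Xbar ((T / N) * (⌊t / (T / N)⌋ : ℝ)) ω) ^ (α - 1)
                * (W t ω - W ((T / N) * (⌊t / (T / N)⌋ : ℝ)) ω)
              + ((b (Xbar ((T / N) * (⌊t / (T / N)⌋ : ℝ)) ω) - b 0)
                  / (Xbar ((T / N) * (⌊t / (T / N)⌋ : ℝ)) ω)
                - σ ^ 2 / 2 * (Xbar ((T / N) * (⌊t / (T / N)⌋ : ℝ)) ω) ^ (2 * (α - 1)))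
              * (t - (T / N) * (⌊t / (T / N)⌋ : ℝ)))) →
      ∀ t : ℝ, 0 ≤ t → t ≤ T →
        ∫ ω, (Xbar t ω) ^ (2 * p) ∂P ≤ C * (1 + x ^ (2 * p)) := by
  obtain ⟨L, hL, hlip⟩ := hblip
  set q := 2 * p with hqdef
  set r := max q 1 with hr
  have hr1 : 1 ≤ r := le_max_right _ _
  have hr2 : r ≤ 1 + 2 * B₂ / σ ^ 2 := 
    max_le hp' (le_add_of_nonneg_right (by positivity))
  set K := Real.exp (r * (B₁ + 1) * T) * (1 + T * b 0 ^ r) with hK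
  have hc' : 0 ≤ b 0 ^ r := Real.rpow_nonneg hb0 _
  have hKpos : 0 < K := by positivity
  refine ⟨max K (K ^ q), ?_⟩
  intro x hx N hN Ω mΩ P hP W hW _ hG hI X hX0 hrec hinterp t ht0 htT
  have hN0 : (0 : ℝ) < N := by exact_mod_cast hN
  have hD : 0 < T / N := by positivity
  have hpos : ∀ n : ℕ, n ≤ N → ∀ ω, 0 < X (n * (T / N)) ω := by
    intro n
    induction n with
    | zero => intro _ ω; simpa [hX0] using hx
    | succ n ih =>
      intro hn ω
      push_cast
      rw [hrec n (by omega) ω]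
      have := ih (by omega) ω
      positivity
  set β : ℝ → ℝ := fun z => b (max 0 z) with hβ
  have hβm : Measurable β := (aux_cont (2 * (α - 1)) L (by linarith) b hlip).measurable
  have hβe : ∀ z, 0 ≤ z → β z = b z := fun z hz => by simp [hβ, max_eq_right hz]
  have hβ0 : β 0 = b 0 := hβe 0 le_rfl
  have hstp : ∀ d z g, 0 < z → stp β α σ d z g = stp b α σ d z g := by
    intro d z g hz
    unfold stp
    rw [hβ0, hβe z hz.le]
  set n := ⌊t / (T / N)⌋₊ with hn
  have hfl : ((⌊t / (T / N)⌋ : ℤ) : ℝ) = n := by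
    rw [hn, natCast_floor_eq_intCast_floor (by positivity)]
  have hnt : n * (T / N) ≤ t := by
    have := Nat.floor_le (show 0 ≤ t / (T / N) by positivity)
    rwa [le_div_iff₀ hD] at this
  have hnN : n ≤ N := by
    have h1 : t / (T / N) ≤ N := by
      rw [div_le_iff₀ hD]
      calc t ≤ T := htT
        _ = N * (T / N) := by field_simp
    have := Nat.floor_le_floor h1
    simpa using this
  have hXt : ∀ ω, X t ω = b 0 * (t - n * (T / N)) + stp b α σ (t - n * (T / N))
      (X ((n : ℝ) * (T / N)) ω) (W t ω - W ((n : ℝ) * (T / N)) ω) := by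
    intro ω
    have := hinterp t ht0 htT ω
    rw [hfl, mul_comm (T / N) (n : ℝ)] at this
    exact this
  have hXpos : ∀ ω, 0 ≤ X t ω := by
    intro ω
    rw [hXt ω]
    have h1 := hpos n hnN ω
    have h2 : 0 ≤ t - n * (T / N) := by linarith
    unfold stp
    positivity
  obtain ⟨hm, hbd⟩ := main_q P α σ B₁ B₂ T β hσ hT hβm hB₁ (by rw [hβ0]; exact hb0)
    (by intro z hz; rw [hβ0, hβe z hz]; exact hb z hz) r hr1 hr2 x hx N hN W hW hG hI X hX0 hpos
    (by intro k hk ω; rw [hβ0, hstp _ _ _ (hpos k hk.le ω)]; exact hrec k hk ω) t n hnN hnt htT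
    (by intro ω; rw [hβ0, hstp _ _ _ (hpos n hnN ω)]; exact hXt ω)
  rw [hβ0] at hbd
  have hxr : 0 ≤ x ^ r := Real.rpow_nonneg hx.le _
  have hxq : 0 ≤ x ^ q := Real.rpow_nonneg hx.le _
  have hA : Real.exp (r * (B₁ + 1) * t) * (x ^ r + t * b 0 ^ r) ≤ K * (1 + x ^ r) := by
    rw [hK, mul_assoc (Real.exp (r * (B₁ + 1) * T))]
    have h1 : Real.exp (r * (B₁ + 1) * t) ≤ Real.exp (r * (B₁ + 1) * T) := by
      apply Real.exp_le_exp.2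
      gcongr
    have h2 : x ^ r + t * b 0 ^ r ≤ (1 + T * b 0 ^ r) * (1 + x ^ r) := by
      have h3 : t * b 0 ^ r ≤ T * b 0 ^ r := by gcongr
      have h4 : 0 ≤ T * b 0 ^ r * x ^ r := by positivity
      nlinarith
    exact mul_le_mul h1 h2 (by positivity) (Real.exp_pos _).le
  obtain ⟨hinteg, hle1⟩ := int_of_lint P (fun ω => X t ω ^ r) (hm.pow_const r)
    (fun ω => Real.rpow_nonneg (hXpos ω) _) (K * (1 + x ^ r)) (by positivity)
    (hbd.trans (ENNReal.ofReal_le_ofReal hA))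
  rcases le_total 1 q with h | h
  · have hrq : r = q := max_eq_left h
    rw [hrq] at hle1
    refine hle1.trans ?_
    gcongr
    exact le_max_left _ _
  · have hrq : r = 1 := max_eq_right h
    rw [hrq] at hle1 hinteg
    simp only [Real.rpow_one] at hle1 hinteg
    set M := K * (1 + x) with hM
    have hMpos : 0 < M := by positivity
    have h1 : ∫ ω, X t ω ^ q ∂P ≤ ∫ ω, M ^ q * (q * (X t ω / M) + (1 - q)) ∂P := by
      refine integral_mono_of_nonneg
        (Filter.Eventually.of_forall fun ω => Real.rpow_nonneg (hXpos ω) _)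
        ((((hinteg.div_const M).const_mul q).add (integrable_const _)).const_mul _)
        (Filter.Eventually.of_forall fun ω => young q M _ hp h hMpos (hXpos ω))
    have h2 : ∫ ω, M ^ q * (q * (X t ω / M) + (1 - q)) ∂P
        = M ^ q * (q * ((∫ ω, X t ω ∂P) / M) + (1 - q)) := by
      rw [integral_const_mul, integral_add ((hinteg.div_const M).const_mul q) (integrable_const _),
        integral_const_mul, integral_div]
      simp
    have h3 : (∫ ω, X t ω ∂P) / M ≤ 1 := (div_le_one hMpos).2 hle1
    have h4 : M ^ q * (q * ((∫ ω, X t ω ∂P) / M) + (1 - q)) ≤ M ^ q := by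
      apply mul_le_of_le_one_right (by positivity)
      nlinarith
    have h5 : M ^ q ≤ K ^ q * (1 + x ^ q) := by
      rw [hM, Real.mul_rpow hKpos.le (by positivity)]
      have := Real.rpow_add_le_add_rpow (p := q) zero_le_one hx.le hp.le h
      rw [Real.one_rpow] at this
      gcongr
    rw [h2] at h1
    refine (h1.trans (h4.trans h5)).trans ?_
    gcongr
    exact le_max_right _ _
end

section
/- Let α > 1, σ > 0, x > 0, T > 0, N ≥ 1 an integer, Δt = T/N, and let b : [0,∞) → ℝ satisfy b(0) ≥ 0. Let W : [0,T] → ℝ be an arbitrary function with W_0 = 0, and let X̄ be the continuous interpolation of the exponential-Euler scheme driven by W, with η(t) = Δt·⌊t/Δt⌋ and δ(t) = t − η(t). Then X̄_t − b(0)δ(t) > 0 for all t ∈ [0,T]; in particular X̄_t > 0 for all t ∈ [0,T]. -/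
open Real

/-- Positivity of the continuous interpolation of the exponential-Euler
scheme: `X̄_t − b(0)δ(t) > 0` and in particular `X̄_t > 0` for all `t ∈ [0,T]`. -/
theorem stmt_5 (α σ x T : ℝ) (N : ℕ) (b : ℝ → ℝ) (W : ℝ → ℝ) (Xbar : ℝ → ℝ)
    (hα : 1 < α) (hσ : 0 < σ) (hx : 0 < x) (hT : 0 < T) (hN : 1 ≤ N)
    (hb0 : 0 ≤ b 0) (hW0 : W 0 = 0)
    -- initial condition
    (hX0 : Xbar 0 = x)
    -- grid recursion with increments `ΔW_n = W_{t_{n+1}} − W_{t_n}`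
    (hgrid : ∀ n : ℕ, n < N → Xbar (((n : ℝ) + 1) * (T / N))
        = b 0 * (T / N) + Xbar ((n : ℝ) * (T / N))
          * Real.exp (σ * (Xbar ((n : ℝ) * (T / N))) ^ (α - 1)
              * (W (((n : ℝ) + 1) * (T / N)) - W ((n : ℝ) * (T / N)))
            + ((b (Xbar ((n : ℝ) * (T / N))) - b 0) / (Xbar ((n : ℝ) * (T / N)))
              - σ ^ 2 / 2 * (Xbar ((n : ℝ) * (T / N))) ^ (2 * (α - 1))) * (T / N)))
    -- continuous interpolation, with `η(t) = Δt⌊t/Δt⌋` and `δ(t) = t − η(t)`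
    (hinterp : ∀ t : ℝ, 0 ≤ t → t ≤ T → Xbar t
        = b 0 * (t - (T / N) * (⌊t / (T / N)⌋ : ℝ))
          + Xbar ((T / N) * (⌊t / (T / N)⌋ : ℝ))
          * Real.exp (σ * (Xbar ((T / N) * (⌊t / (T / N)⌋ : ℝ))) ^ (α - 1)
              * (W t - W ((T / N) * (⌊t / (T / N)⌋ : ℝ)))
            + ((b (Xbar ((T / N) * (⌊t / (T / N)⌋ : ℝ))) - b 0)
                / (Xbar ((T / N) * (⌊t / (T / N)⌋ : ℝ)))
              - σ ^ 2 / 2 * (Xbar ((T / N) * (⌊t / (T / N)⌋ : ℝ))) ^ (2 * (α - 1)))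
            * (t - (T / N) * (⌊t / (T / N)⌋ : ℝ)))) :
    ∀ t : ℝ, 0 ≤ t → t ≤ T →
      0 < Xbar t - b 0 * (t - (T / N) * (⌊t / (T / N)⌋ : ℝ)) ∧ 0 < Xbar t := by
  have hNpos : (0 : ℝ) < N := by exact_mod_cast hN
  have hd : 0 < T / N := div_pos hT hNpos
  have key : ∀ n : ℕ, n ≤ N → 0 < Xbar ((n : ℝ) * (T / N)) := by
    intro n
    induction n with
    | zero => intro _; simpa [hX0] using hx
    | succ k ih =>
      intro hk
      have h1 := ih (by omega)
      have h2 := hgrid k (by omega)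
      push_cast
      rw [h2]
      exact add_pos_of_nonneg_of_pos (mul_nonneg hb0 hd.le) (mul_pos h1 (Real.exp_pos _))
  intro t ht0 htT
  have hq : 0 ≤ t / (T / N) := div_nonneg ht0 hd.le
  obtain ⟨m, hm⟩ := Int.eq_ofNat_of_zero_le (Int.floor_nonneg.mpr hq)
  have hfl : (⌊t / (T / N)⌋ : ℝ) * (T / N) ≤ t := (le_div_iff₀ hd).mp (Int.floor_le _)
  have hmN : m ≤ N := by
    have h1 : (⌊t / (T / N)⌋ : ℝ) ≤ t / (T / N) := Int.floor_le _
    have h2 : t / (T / N) ≤ N := by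
      rw [div_le_iff₀ hd, mul_div_cancel₀ _ hNpos.ne']
      exact htT
    rw [hm] at h1
    have h3 : (m : ℝ) ≤ N := by
      have := h1.trans h2
      simpa using this
    exact_mod_cast h3
  have hη : 0 < Xbar ((T / N) * (⌊t / (T / N)⌋ : ℝ)) := by
    have := key m hmN
    rw [hm, mul_comm]
    simpa using this
  have hδ : 0 ≤ b 0 * (t - (T / N) * (⌊t / (T / N)⌋ : ℝ)) :=
    mul_nonneg hb0 (by linarith)
  have hmain : 0 < Xbar t - b 0 * (t - (T / N) * (⌊t / (T / N)⌋ : ℝ)) := by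
    have h := hinterp t ht0 htT
    have h4 := sub_eq_iff_eq_add'.mpr h
    rw [h4]
    exact mul_pos hη (Real.exp_pos _)
  exact ⟨hmain, by linarith⟩
end

section
/- For all c > 0, k > 0 and β̃ > 2, the double integral ∫_c^∞ y^{−β̃} e^{−ky} ( ∫_c^y z^{β̃−1} e^{kz} dz ) dy equals +∞. -/
open Real MeasureTheory

theorem aux_inner (c k β : ℝ) (hc : 0 < c) (hk : 0 < k) (hβ : 2 < β) (y : ℝ) (hy : c + 1 < y) :
    (c / (c + 1)) ^ (β - 1) * Real.exp (-k) * y⁻¹ ≤ y ^ (-β) * Real.exp (-(k * y))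
        * ∫ z in c..y, z ^ (β - 1) * Real.exp (k * z) := by
  have hy0 : 0 < y := by linarith
  have hint : ∀ a b : ℝ, IntervalIntegrable (fun z : ℝ => z ^ (β - 1) * Real.exp (k * z))
      volume a b := by
    intro a b
    apply Continuous.intervalIntegrable
    exact (Real.continuous_rpow_const (by linarith)).mul (by fun_prop)
  have h1 : 0 ≤ ∫ z in c..(y - 1), z ^ (β - 1) * Real.exp (k * z) := by
    apply intervalIntegral.integral_nonneg (by linarith)
    intro u hu
    have : 0 < u := by linarith [hu.1]
    positivity
  have h2 : (y - 1) ^ (β - 1) * Real.exp (k * (y - 1)) ≤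
      ∫ z in (y - 1)..y, z ^ (β - 1) * Real.exp (k * z) := by
    have h := intervalIntegral.integral_mono_on (a := y - 1) (b := y) (μ := volume)
      (f := fun _ : ℝ => (y - 1) ^ (β - 1) * Real.exp (k * (y - 1))) (by linarith)
      (by simp) (hint (y - 1) y) (by
        intro x hx
        have hx1 := hx.1
        have : (0 : ℝ) ≤ y - 1 := by linarith
        have h3 : (y - 1) ^ (β - 1) ≤ x ^ (β - 1) :=
          Real.rpow_le_rpow this hx1 (by linarith)
        have h4 : Real.exp (k * (y - 1)) ≤ Real.exp (k * x) := by
          apply Real.exp_le_exp.mpr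
          exact mul_le_mul_of_nonneg_left hx1 hk.le
        have := Real.rpow_nonneg this (β - 1)
        exact mul_le_mul h3 h4 (Real.exp_pos _).le (this.trans h3))
    simpa using h
  have h3 : (y - 1) ^ (β - 1) * Real.exp (k * (y - 1)) ≤
      ∫ z in c..y, z ^ (β - 1) * Real.exp (k * z) := by
    rw [← intervalIntegral.integral_add_adjacent_intervals (hint c (y - 1)) (hint (y - 1) y)]
    linarith
  have h4 : (c / (c + 1) * y) ^ (β - 1) ≤ (y - 1) ^ (β - 1) := by
    apply Real.rpow_le_rpow (by positivity) _ (by linarith)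
    rw [div_mul_eq_mul_div, div_le_iff₀ (by linarith)]
    nlinarith
  have h5 : y ^ (-β) * y ^ (β - 1) = y⁻¹ := by
    rw [← Real.rpow_add hy0, ← Real.rpow_neg_one]; congr 1; ring
  have h6 : Real.exp (-(k * y)) * Real.exp (k * (y - 1)) = Real.exp (-k) := by
    rw [← Real.exp_add]; congr 1; ring
  calc _ = y ^ (-β) * Real.exp (-(k * y)) *
        ((c / (c + 1) * y) ^ (β - 1) * Real.exp (k * (y - 1))) := by
        rw [← h5, ← h6, Real.mul_rpow (by positivity) hy0.le]; ring
    _ ≤ y ^ (-β) * Real.exp (-(k * y)) *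
        ((y - 1) ^ (β - 1) * Real.exp (k * (y - 1))) := by gcongr
    _ ≤ _ := by gcongr

/-- Feller-test divergence at `+∞` (case `b(0) = 0`): for `c > 0`, `k > 0`
and `β̃ > 2`, the double integral `∫_c^∞ y^{−β̃} e^{−ky} (∫_c^y z^{β̃−1} e^{kz} dz) dy` is
infinite. -/
theorem stmt_10 (c k β : ℝ) (hc : 0 < c) (hk : 0 < k) (hβ : 2 < β) :
    ∫⁻ y in Set.Ioi c,
      ENNReal.ofReal (y ^ (-β) * Real.exp (-(k * y))
        * ∫ z in c..y, z ^ (β - 1) * Real.exp (k * z)) = ⊤ := by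
  set C : ℝ := (c / (c + 1)) ^ (β - 1) * Real.exp (-k) with hC
  have hCpos : 0 < C := by positivity
  have key : ∫⁻ y in Set.Ioi (c + 1), ENNReal.ofReal (C * y⁻¹) = ⊤ := by
    by_contra hne
    have hI : IntegrableOn (fun y : ℝ => C * y⁻¹) (Set.Ioi (c + 1)) := by
      refine (lintegral_ofReal_ne_top_iff_integrable (by fun_prop) ?_).mp hne
      filter_upwards [ae_restrict_mem measurableSet_Ioi] with y hy
      have : 0 < y := by linarith [Set.mem_Ioi.mp hy]
      simp only [Pi.zero_apply]
      positivity
    have hJ := hI.const_mul C⁻¹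
    simp only [← mul_assoc, inv_mul_cancel₀ hCpos.ne', one_mul] at hJ
    exact not_integrableOn_Ioi_inv hJ
  rw [← top_le_iff, ← key]
  calc _ ≤ ∫⁻ y in Set.Ioi (c + 1), ENNReal.ofReal (y ^ (-β) * Real.exp (-(k * y))
        * ∫ z in c..y, z ^ (β - 1) * Real.exp (k * z)) := by
        apply setLIntegral_mono' measurableSet_Ioi
        intro y hy
        exact ENNReal.ofReal_le_ofReal (aux_inner c k β hc hk hβ y hy)
    _ ≤ _ := lintegral_mono_set (Set.Ioi_subset_Ioi (by linarith))
end

section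
/- Let α > 1, σ > 0, L ≥ 0 and let b : [0,∞) → ℝ satisfy |b(u) − b(v)| ≤ L(1 + u^{2(α−1)} + v^{2(α−1)})|u − v| for all u, v ≥ 0. Define b̃(x) = (α−1)·( σ²(2α−1) − 2 x^{(2α−1)/(2(α−1))} · b( x^{−1/(2(α−1))} ) ) for x > 0. Then for all x > 0, b̃(x) ≤ (α−1)·( 2L + (2α−1)σ² + 2L·x − 2 b(0)·x^{(2α−1)/(2(α−1))} ). -/
open Real

/-- Upper bound on the drift `b̃` of the Lamperti-transformed process:
if `b` is `2(α−1)`-locally Lipschitz with constant `L`, then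
`b̃(x) ≤ (α−1)(2L + (2α−1)σ² + 2L x − 2 b(0) x^{(2α−1)/(2(α−1))})` for all `x > 0`. -/
theorem stmt_12 (α σ L : ℝ) (b : ℝ → ℝ)
    (hα : 1 < α) (hσ : 0 < σ) (hL : 0 ≤ L)
    (hblip : ∀ u v : ℝ, 0 ≤ u → 0 ≤ v →
      |b u - b v| ≤ L * (1 + u ^ (2 * (α - 1)) + v ^ (2 * (α - 1))) * |u - v|) :
    ∀ x : ℝ, 0 < x →
      (α - 1) * (σ ^ 2 * (2 * α - 1)
          - 2 * x ^ ((2 * α - 1) / (2 * (α - 1))) * b (x ^ (-(1 : ℝ) / (2 * (α - 1)))))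
        ≤ (α - 1) * (2 * L + (2 * α - 1) * σ ^ 2 + 2 * L * x
          - 2 * b 0 * x ^ ((2 * α - 1) / (2 * (α - 1)))) := by
  intro x hx
  have ha : 0 < 2 * (α - 1) := by linarith
  have hne : 2 * (α - 1) ≠ 0 := ha.ne'
  have hne' : α - 1 ≠ 0 := by linarith
  have hPy : x ^ ((2 * α - 1) / (2 * (α - 1))) * x ^ (-(1 : ℝ) / (2 * (α - 1))) = x := by
    rw [← Real.rpow_add hx]
    have : (2 * α - 1) / (2 * (α - 1)) + -(1 : ℝ) / (2 * (α - 1)) = 1 := by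
      rw [← add_div, div_eq_one_iff_eq hne]; ring
    rw [this, Real.rpow_one]
  have hy : (x ^ (-(1 : ℝ) / (2 * (α - 1)))) ^ (2 * (α - 1)) = x⁻¹ := by
    rw [← Real.rpow_mul hx.le, div_mul_cancel₀ _ hne, Real.rpow_neg_one]
  have hP : 0 < x ^ ((2 * α - 1) / (2 * (α - 1))) := Real.rpow_pos_of_pos hx _
  have hy0 : 0 < x ^ (-(1 : ℝ) / (2 * (α - 1))) := Real.rpow_pos_of_pos hx _
  have h := hblip _ 0 hy0.le le_rfl
  rw [hy, Real.zero_rpow hne, sub_zero, abs_of_pos hy0] at h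
  generalize x ^ ((2 * α - 1) / (2 * (α - 1))) = P at *
  generalize x ^ (-(1 : ℝ) / (2 * (α - 1))) = y at *
  have h1 := (abs_le.1 h).1
  have h2 : P * (b 0 - b y) ≤ P * (L * (1 + x⁻¹ + 0) * y) :=
    mul_le_mul_of_nonneg_left (by linarith) hP.le
  have h3 : P * (L * (1 + x⁻¹ + 0) * y) = L * x + L := by
    have : P * (L * (1 + x⁻¹ + 0) * y) = L * (1 + x⁻¹) * (P * y) := by ring
    rw [this, hPy]
    field_simp
  apply mul_le_mul_of_nonneg_left _ (by linarith)
  linarith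
end
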